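/- The element h generates K over E (i.e., E⟮h⟯ = ⊤ as intermediate fields of K over E), and the six powers h⁰, h¹, h², h³, h⁴, h⁵ are linearly independent over E, hence form a basis of K as an E-vector space. -/

import Mathlib

noncomputable section

abbrev R2 : Type := MvPolynomial (Fin 2) ℝ

def x : R2 := MvPolynomial.X 0
def y : R2 := MvPolynomial.X 1
def t : R2 := x * y - 1
def h : R2 := t * (x * t + 1)
def f : R2 := (x * t + 1) ^ 2 * (t ^ 2 + y)
def P : R2 := f + h
def q : R2 := -t ^ 2 - 6 * t * h * (h + 1)
def u : R2 :=
  170 * f * h + 91 * h ^ 2 + 195 * f * h ^ 2 + 69 * h ^ 3 + 75 * f * h ^ 3 + MvPolynomial.C (75 / 4 : ℝ) * h ^ 4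
def Q : R2 := q - u

abbrev K : Type := FractionRing (MvPolynomial (Fin 2) ℝ)

/-- The canonical image of a polynomial in the rational function field `K = ℝ(x,y)`. -/
def ι : R2 →+* K := algebraMap R2 K

/-- The images of `P`, `Q`, `h` in the rational function field `K`. -/
def PK : K := ι P
def QK : K := ι Q
def hK : K := ι h

/-- `E = ℝ(P,Q)`, the intermediate field of `K` over `ℝ` generated by `P` and `Q`. -/
def E : IntermediateField ℝ K := IntermediateField.adjoin ℝ ({PK, QK} : Set K)

open Polynomial IntermediateField Filter

section RationalFunction

variable {F M : Type*} [Field F] [Field M] [Algebra F M]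

/-- Evaluating `p` at the fraction `A(z) / D(z)` and clearing denominators gives a polynomial in
`z` which is congruent to `p(0) * D ^ n` modulo `A`. -/
theorem eventually_exists_pow_mul_aeval_div {z : M} {A D : F[X]} (hD : aeval z D ≠ 0) (p : F[X]) :
    ∀ᶠ n in atTop, ∃ r : F[X], aeval z D ^ n * aeval (aeval z A / aeval z D) p =
      aeval z (C (p.coeff 0) * D ^ n + A * r) := by
  refine eventually_atTop.2 ⟨p.natDegree, fun n hn ↦
    ⟨∑ j ∈ Finset.range n, C (p.coeff (j + 1)) * A ^ j * D ^ (n - (j + 1)), ?_⟩⟩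
  rw [aeval_eq_sum_range' (Nat.lt_succ_of_le hn), Finset.sum_range_succ', mul_add, add_comm,
    map_add, map_mul, map_mul, map_sum, Finset.mul_sum, Finset.mul_sum]
  congr 1
  · simp [Algebra.smul_def, mul_comm]
  · refine Finset.sum_congr rfl fun j hj ↦ ?_
    obtain ⟨k, rfl⟩ := Nat.exists_eq_add_of_le (Nat.succ_le_of_lt (Finset.mem_range.1 hj))
    simp only [Algebra.smul_def, map_mul, map_pow, aeval_C, Nat.succ_eq_add_one,
      Nat.add_sub_cancel_left, div_pow]
    field_simp
    ring

theorem coeff_eq_zero_of_sum_aeval_div_mul_pow_eq_zero {z : M} (hz : Transcendental F z)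
    {A D : F[X]} (hAD : IsCoprime A D) (hA : A ≠ 0) (hD : D ≠ 0) (n : ℕ) :
    ∀ p : Fin A.natDegree → F[X],
      ∑ i, aeval (aeval z A / aeval z D) (p i) * z ^ (i : ℕ) = 0 → ∀ i, (p i).coeff n = 0 := by
  have hinj := transcendental_iff_injective.1 hz
  have hA' : aeval z A ≠ 0 := (map_ne_zero_iff _ hinj).2 hA
  have hD' : aeval z D ≠ 0 := (map_ne_zero_iff _ hinj).2 hD
  have const_coeff : ∀ p : Fin A.natDegree → F[X],
      ∑ i, aeval (aeval z A / aeval z D) (p i) * z ^ (i : ℕ) = 0 → ∀ i, (p i).coeff 0 = 0 := by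
    intro p hp
    obtain ⟨n, hn⟩ :=
      (eventually_all.2 fun i ↦ eventually_exists_pow_mul_aeval_div (A := A) hD' (p i)).exists
    choose r hr using hn
    have hsum : ∑ i, (C ((p i).coeff 0) * D ^ n + A * r i) * X ^ (i : ℕ) = 0 := by
      apply hinj
      simp only [map_sum, map_mul _ (_ + _), ← hr, map_zero, map_pow _ X, aeval_X, mul_assoc,
        ← Finset.mul_sum, hp, mul_zero]
    have hdvd : A ∣ D ^ n * ∑ i, C ((p i).coeff 0) * X ^ (i : ℕ) := by
      refine ⟨-∑ i, r i * X ^ (i : ℕ), ?_⟩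
      rw [mul_neg, eq_neg_iff_add_eq_zero, ← hsum, Finset.mul_sum, Finset.mul_sum,
        ← Finset.sum_add_distrib]
      exact Finset.sum_congr rfl fun i _ ↦ by ring
    have hzero := eq_zero_of_dvd_of_degree_lt (hAD.pow_right.dvd_of_dvd_mul_left hdvd)
      ((degree_sum_fin_lt _).trans_eq (degree_eq_natDegree hA).symm)
    intro i
    simpa [finsetSum_coeff, coeff_X_pow, Fin.val_inj] using congr_arg (coeff · (i : ℕ)) hzero
  induction n with
  | zero => exact const_coeff
  | succ n ih =>
    intro p hp i
    rw [← coeff_divX]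
    refine ih (fun i ↦ (p i).divX) ?_ i
    refine (mul_eq_zero.1 ?_).resolve_left (div_ne_zero hA' hD')
    rw [← hp, Finset.mul_sum]
    refine Finset.sum_congr rfl fun j _ ↦ ?_
    conv_rhs => rw [← X_mul_divX_add (p j), const_coeff p hp j]
    simp [mul_assoc]

open scoped algebraAdjoinAdjoin in
/-- If `z` is transcendental over `F` and `w = A(z) / D(z)` is a reduced fraction, then the powers
of `z` with exponent less than the degree of `A` are linearly independent over `F(w)`. -/
theorem linearIndependent_pow_adjoin_aeval_div {z : M} (hz : Transcendental F z)
    {A D : F[X]} (hAD : IsCoprime A D) (hA : A ≠ 0) (hD : D ≠ 0) :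
    LinearIndependent F⟮aeval z A / aeval z D⟯ (fun i : Fin A.natDegree ↦ z ^ (i : ℕ)) := by
  rw [← LinearIndependent.iff_fractionRing (R := Algebra.adjoin F {aeval z A / aeval z D}),
    Fintype.linearIndependent_iff]
  intro g hg i
  have hmem (i) : ∃ p : F[X], aeval (aeval z A / aeval z D) p = (g i : M) := by
    simpa [Algebra.adjoin_singleton_eq_range_aeval] using (g i).2
  choose p hp using hmem
  have hpi : p i = 0 := Polynomial.ext fun n ↦ by
    refine coeff_eq_zero_of_sum_aeval_div_mul_pow_eq_zero hz hAD hA hD n p ?_ i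
    simpa only [hp, Subalgebra.smul_def, smul_eq_mul] using hg
  ext
  simp [← hp, hpi]

end RationalFunction

theorem ι_injective : Function.Injective ι := IsFractionRing.injective R2 K

theorem ι_ne_zero_of_eval_ne_zero {p : R2} (a : Fin 2 → ℝ) (ha : MvPolynomial.eval a p ≠ 0) :
    ι p ≠ 0 :=
  (map_ne_zero_iff ι ι_injective).2 fun hp ↦ ha (by simp [hp])

theorem ι_f_ne_zero : ι f ≠ 0 :=
  ι_ne_zero_of_eval_ne_zero ![0, 2] (by norm_num [f, t, x, y])

theorem ι_t_ne_zero : ι t ≠ 0 :=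
  ι_ne_zero_of_eval_ne_zero ![0, 2] (by norm_num [t, x, y])

theorem ι_x_ne_zero : ι x ≠ 0 :=
  ι_ne_zero_of_eval_ne_zero ![1, 2] (by norm_num [x])

theorem PK_ne_zero : PK ≠ 0 :=
  ι_ne_zero_of_eval_ne_zero ![0, 2] (by norm_num [P, h, f, t, x, y])

theorem PK_add_one_ne_zero : PK + 1 ≠ 0 := by
  have := ι_ne_zero_of_eval_ne_zero (p := P + 1) ![0, 2] (by norm_num [P, h, f, t, x, y])
  simpa [PK] using this

theorem PK_eq : PK = ι f + hK := by simp [PK, hK, P]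

theorem ι_t_mul_ι_f : ι t * ι f = hK * (ι f - hK ^ 2 - hK) := by
  simp only [hK, ← map_mul, ← map_sub, ← map_pow]
  congr 1
  simp only [f, h, t]
  ring

theorem ι_range_le {L : Subfield K} (hℝ : ∀ r : ℝ, algebraMap ℝ K r ∈ L) (hx : ι x ∈ L)
    (hy : ι y ∈ L) (p : R2) : ι p ∈ L := by
  induction p using MvPolynomial.induction_on with
  | C r => exact hℝ r
  | add p q hp hq => simpa using add_mem hp hq
  | mul_X p i hp =>
    rw [map_mul]
    refine mul_mem hp ?_
    fin_cases i
    exacts [hx, hy]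

/-- The rational function field `ℝ(x, y)` is generated by `P` and `h`. -/
theorem eq_top_of_PK_mem_of_hK_mem {L : IntermediateField ℝ K} (hP : PK ∈ L) (hh : hK ∈ L) :
    L = ⊤ := by
  have hf : ι f ∈ L := by
    rw [eq_sub_of_add_eq PK_eq.symm]
    exact sub_mem hP hh
  have ht : ι t ∈ L := by
    rw [eq_div_of_mul_eq ι_f_ne_zero ι_t_mul_ι_f]
    exact div_mem (mul_mem hh (sub_mem (sub_mem hf (pow_mem hh 2)) hh)) hf
  have hx : ι x ∈ L := by
    have : ι x * ι t ^ 2 = hK - ι t := by simp [hK, h]; ring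
    rw [eq_div_of_mul_eq (pow_ne_zero 2 ι_t_ne_zero) this]
    exact div_mem (sub_mem hh ht) (pow_mem ht 2)
  have hy : ι y ∈ L := by
    have : ι y * ι x = ι t + 1 := by simp [t]; ring
    rw [eq_div_of_mul_eq ι_x_ne_zero this]
    exact div_mem (add_mem ht (one_mem L)) hx
  refine _root_.eq_top_iff.2 fun k _ ↦ ?_
  obtain ⟨a, b, -, rfl⟩ := IsFractionRing.div_surjective (A := R2) k
  have hι := ι_range_le (L := L.toSubfield) L.algebraMap_mem hx hy
  exact div_mem (hι a) (hι b)

theorem adjoin_hK_eq_top {L : IntermediateField ℝ K} (hP : PK ∈ L) : adjoin L {hK} = ⊤ := by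
  rw [← restrictScalars_eq_top_iff (K := ℝ)]
  exact eq_top_of_PK_mem_of_hK_mem ((adjoin L {hK}).algebraMap_mem ⟨PK, hP⟩)
    (mem_adjoin_simple_self L hK)

open scoped algebraAdjoinAdjoin in
theorem transcendental_hK : Transcendental ℝ⟮PK⟯ hK := by
  intro halg
  have h₁ : Algebra.IsAlgebraic ℝ⟮PK⟯ ℝ⟮PK⟯⟮hK⟯ := isAlgebraic_adjoin_simple halg.isIntegral
  rw [adjoin_hK_eq_top (mem_adjoin_simple_self ℝ PK)] at h₁
  have h₂ : Algebra.IsAlgebraic ℝ⟮PK⟯ K := topEquiv.isAlgebraic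
  have h₃ : Algebra.IsAlgebraic (Algebra.adjoin ℝ {PK}) K := .trans _ ℝ⟮PK⟯ _
  have upper := Algebra.IsAlgebraic.trdeg_le_cardinalMk ℝ {PK}
  have lower := trdeg_le_of_injective (IsScalarTower.toAlgHom ℝ R2 K) ι_injective
  rw [MvPolynomial.trdeg_of_isDomain] at lower
  have := lower.trans upper
  simp at this

section Fraction

variable {F : Type*} [Field F]

/-- With `p` in place of `P`, the numerator of `Q` written as a fraction in `h` with denominator
`(P - h) ^ 2`. -/
def numQ (p : F) : F[X] :=
  6 * X ^ 2 * (X + 1) * (X ^ 2 + 2 * X - C p) * (C p - X) - X ^ 2 * (X ^ 2 + 2 * X - C p) ^ 2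
    - (170 * (C p - X) * X + 91 * X ^ 2 + 195 * (C p - X) * X ^ 2 + 69 * X ^ 3
      + 75 * (C p - X) * X ^ 3 + C (75 / 4) * X ^ 4) * (C p - X) ^ 2

theorem natDegree_numQ [CharZero F] (p : F) : (numQ p).natDegree = 6 := by
  unfold numQ
  compute_degree!

theorem eval_numQ (p : F) : (numQ p).eval p = -(p ^ 2 * (p + 1)) ^ 2 := by
  simp [numQ]
  ring

theorem isCoprime_numQ {p : F} (h₀ : p ≠ 0) (h₁ : p + 1 ≠ 0) :
    IsCoprime (numQ p) ((C p - X) ^ 2) := by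
  refine IsCoprime.pow_right (IsCoprime.symm ?_)
  rw [← neg_sub, IsCoprime.neg_left_iff, (irreducible_X_sub_C p).coprime_iff_not_dvd, dvd_iff_isRoot,
    IsRoot.def, eval_numQ]
  simp [h₀, h₁]

end Fraction

theorem aeval_numQ {F : IntermediateField ℝ K} (p : F) (hp : (p : K) = PK) :
    aeval hK (numQ p) / aeval hK ((C p - X) ^ 2) = QK := by
  have hden : aeval hK (C p - X) = ι f := by simp [hp, PK_eq]
  rw [map_pow, hden, div_eq_iff (pow_ne_zero 2 ι_f_ne_zero)]
  have hC : ι (MvPolynomial.C (75 / 4)) = 75 / 4 := by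
    change algebraMap R2 K (algebraMap ℝ R2 _) = _
    rw [← IsScalarTower.algebraMap_apply, map_div₀, map_ofNat, map_ofNat]
  have hQ : QK = -ι t ^ 2 - 6 * ι t * hK * (hK + 1) - (170 * ι f * hK + 91 * hK ^ 2
      + 195 * ι f * hK ^ 2 + 69 * hK ^ 3 + 75 * ι f * hK ^ 3 + 75 / 4 * hK ^ 4) := by
    simp [QK, Q, q, u, hC, hK, map_ofNat]
  have hnum : aeval hK (numQ p) = -(hK * (ι f - hK ^ 2 - hK)) ^ 2
      - 6 * (hK * (ι f - hK ^ 2 - hK)) * ι f * hK * (hK + 1)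
      - (170 * ι f * hK + 91 * hK ^ 2
      + 195 * ι f * hK ^ 2 + 69 * hK ^ 3 + 75 * ι f * hK ^ 3 + 75 / 4 * hK ^ 4) * ι f ^ 2 := by
    simp [numQ, hp, PK_eq, map_ofNat]
    ring
  rw [hnum, hQ, ← ι_t_mul_ι_f]
  ring

theorem linearIndependent_pow_hK : LinearIndependent E (fun i : Fin 6 ↦ hK ^ (i : ℕ)) := by
  let p : ℝ⟮PK⟯ := AdjoinSimple.gen ℝ PK
  have h₀ : p ≠ 0 := fun H ↦ PK_ne_zero (congr_arg Subtype.val H)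
  have h₁ : p + 1 ≠ 0 := fun H ↦ PK_add_one_ne_zero (congr_arg Subtype.val H)
  have hnum : numQ p ≠ 0 := fun H ↦ by simpa [H] using natDegree_numQ p
  have hden : (C p - X) ^ 2 ≠ 0 :=
    pow_ne_zero 2 (sub_ne_zero.2 (X_ne_C p).symm)
  have hli := linearIndependent_pow_adjoin_aeval_div transcendental_hK (isCoprime_numQ h₀ h₁)
    hnum hden
  rw [aeval_numQ p rfl, natDegree_numQ] at hli
  have hE : E = ℝ⟮PK⟯⟮QK⟯.restrictScalars ℝ := by
    rw [adjoin_adjoin_left, Set.singleton_union, E]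
  rw [hE]
  exact hli

/-- `h` generates `K` over `E = ℝ(P,Q)` and `1, h, h², h³, h⁴, h⁵` are linearly
independent over `E`, hence form a basis of `K` as an `E`-vector space. -/
theorem pinchuk_power_basis :
    IntermediateField.adjoin E ({hK} : Set K) = ⊤ ∧
    LinearIndependent E (fun i : Fin 6 => hK ^ (i : ℕ)) :=
  ⟨adjoin_hK_eq_top (subset_adjoin ℝ _ (Set.mem_insert PK _)), linearIndependent_pow_hK⟩
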